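/- Fix an integer k ≥ 1, real δ > -1 and m ∈ {1,…,k}, and fix θ_0,…,θ_m ≥ 0. Then H_m(e^{−θ_0 z^{−1}}, e^{−θ_1 z^{−b_1/b_0}}, …, e^{−θ_m z^{−b_m/b_0}}, z) → g_m(θ_0,…,θ_m) as z → ∞, where the functions H_m are defined recursively by H_0(x_0,z) = x_0 + z(1−x_0), H_1(x_0,x_1,z) = (1−x_1)z^{b_1/b_0} + x_1(x_0+z(1−x_0))^{b_1/b_0} and H_m(x_0,…,x_m,z) = (1−x_m)z^{b_m/b_0} + x_m H_{m-1}(x_0,…,x_{m-1},z)^{b_m/b_{m-1}} for m = 2,…,k, and the functions g_m are defined recursively by g_0(θ_0) = 1+θ_0 and g_m(θ_0,…,θ_m) = g_{m-1}(θ_0,…,θ_{m-1})^{b_m/b_{m-1}} + θ_m for m = 1,…,k. -/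

import Mathlib

open MeasureTheory Filter Finset

noncomputable section

/-- The coefficient `b_m = k - m + 1 + δ(k - m)`. -/
def bcoef (k : ℕ) (δ : ℝ) (m : ℕ) : ℝ := (k : ℝ) - m + 1 + δ * ((k : ℝ) - m)

/-- The coefficient `τ = k + 2 + δ(k + 1)`. -/
def tauc (k : ℕ) (δ : ℝ) : ℝ := (k : ℝ) + 2 + δ * ((k : ℝ) + 1)

/-- The functions `H_m` of display (4.4) in the paper (with `H_0(x_0,z) = x_0 + z(1-x_0)`). -/
def Hfun (k : ℕ) (δ : ℝ) (x : ℕ → ℝ) (z : ℝ) : ℕ → ℝ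
  | 0 => x 0 + z * (1 - x 0)
  | m + 1 => (1 - x (m + 1)) * z ^ (bcoef k δ (m + 1) / bcoef k δ 0)
      + x (m + 1) * Hfun k δ x z m ^ (bcoef k δ (m + 1) / bcoef k δ m)

/-- The functions `g_m`: `g_0(θ_0) = 1 + θ_0`,
`g_{m+1}(θ_0,…,θ_{m+1}) = g_m(θ_0,…,θ_m)^{b_{m+1}/b_m} + θ_{m+1}`. -/
def gfun (k : ℕ) (δ : ℝ) (θ : ℕ → ℝ) : ℕ → ℝ
  | 0 => 1 + θ 0
  | m + 1 => gfun k δ θ m ^ (bcoef k δ (m + 1) / bcoef k δ m) + θ (m + 1)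

theorem bcoef_pos {k : ℕ} {δ : ℝ} (hδ : -1 < δ) {m : ℕ} (hm : m ≤ k) : 0 < bcoef k δ m := by
  have h : (m : ℝ) ≤ k := by exact_mod_cast hm
  unfold bcoef
  nlinarith

theorem tendsto_exp_neg_mul_rpow_neg (a : ℝ) {c : ℝ} (hc : 0 < c) :
    Tendsto (fun z : ℝ => Real.exp (-a * z ^ (-c))) atTop (nhds 1) := by
  simpa using ((tendsto_rpow_neg_atTop hc).const_mul (-a)).rexp

theorem tendsto_one_sub_exp_mul_rpow (a : ℝ) {c : ℝ} (hc : 0 < c) :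
    Tendsto (fun z : ℝ => (1 - Real.exp (-a * z ^ (-c))) * z ^ c) atTop (nhds a) := by
  have hd : HasDerivAt (fun u : ℝ => Real.exp (-a * u)) (-a) 0 := by
    simpa using ((hasDerivAt_id (0 : ℝ)).const_mul (-a)).exp
  have hu : Tendsto (fun z : ℝ => z ^ (-c)) atTop (nhdsWithin 0 {0}ᶜ) := by
    refine tendsto_nhdsWithin_iff.2 ⟨tendsto_rpow_neg_atTop hc, ?_⟩
    filter_upwards [eventually_gt_atTop 0] with z hz
    exact (Real.rpow_pos_of_pos hz _).ne'
  have h := (hd.tendsto_slope_zero.comp hu).neg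
  rw [neg_neg] at h
  refine h.congr' ?_
  filter_upwards [eventually_gt_atTop 0] with z hz
  simp [Real.rpow_neg hz.le]
  ring

/-- As `z → ∞`,
`H_m(e^{-θ_0 z^{-1}}, e^{-θ_1 z^{-b_1/b_0}}, …, e^{-θ_m z^{-b_m/b_0}}, z) → g_m(θ_0,…,θ_m)`. -/
theorem Hfun_tendsto_gfun (k : ℕ) (hk : 1 ≤ k) (δ : ℝ) (hδ : -1 < δ)
    (m : ℕ) (hm1 : 1 ≤ m) (hmk : m ≤ k) (θ : ℕ → ℝ) (hθ : ∀ i, i ≤ m → 0 ≤ θ i) :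
    Tendsto (fun z : ℝ =>
        Hfun k δ (fun i => Real.exp (-θ i * z ^ (-(bcoef k δ i / bcoef k δ 0)))) z m)
      atTop (nhds (gfun k δ θ m)) := by
  have hb0 : 0 < bcoef k δ 0 := bcoef_pos hδ k.zero_le
  clear hm1 hθ
  induction m with
  | zero =>
    have h := (tendsto_exp_neg_mul_rpow_neg (θ 0) one_pos).add
      (tendsto_one_sub_exp_mul_rpow (θ 0) one_pos)
    simpa only [Hfun, gfun, div_self hb0.ne', Real.rpow_one, mul_comm] using h
  | succ n ih =>
    have hb := bcoef_pos hδ hmk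
    have hbn := bcoef_pos hδ (Nat.le_of_succ_le hmk)
    have h := (tendsto_one_sub_exp_mul_rpow (θ (n + 1)) (div_pos hb hb0)).add
      ((tendsto_exp_neg_mul_rpow_neg (θ (n + 1)) (div_pos hb hb0)).mul
        ((ih (Nat.le_of_succ_le hmk)).rpow_const (Or.inr (div_pos hb hbn).le)))
    rw [one_mul, add_comm (θ (n + 1))] at h
    exact h
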